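/- arXiv:2206.00331 — 2 statements merged into one kernel-verified Lean document; each statement's English description precedes it below -/
import Mathlib

section
/- Let (E, L, τ) and (F, M, υ) be orthogonal isodual Euclidean lattices with dim E ≤ 4, b_τ definite and b_υ Lorentzian. Then H_min of the tensor product of (E, L) and (F, M) equals H_min(E, L)·H_min(F, M). -/
open Module

noncomputable section

namespace EucLat

variable {E : Type*} [NormedAddCommGroup E] [InnerProductSpace ℝ E]

/-- The covolume of a `ℤ`-submodule of a real inner product space: the square root of the
Gram determinant of a `ℤ`-basis (junk value `0` if no finite basis exists). -/
def covol (L : Submodule ℤ E) : ℝ :=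
  @dite _ (∃ n : ℕ, Nonempty (Basis (Fin n) ℤ L)) (Classical.propDecidable _)
    (fun h => Real.sqrt (Matrix.det (Matrix.of fun i j =>
      (inner ℝ ((h.choose_spec.some i : L) : E) ((h.choose_spec.some j : L) : E) : ℝ))))
    (fun _ => 0)

/-- The reduced height `covol(L)^(1/dim E)` of a full lattice. -/
def redH (L : Submodule ℤ E) : ℝ := covol L ^ ((finrank ℝ E : ℝ)⁻¹)

/-- The lattice `L ∩ F` induced on a subspace `F`. -/
def latIn (L : Submodule ℤ E) (F : Submodule ℝ E) : Submodule ℤ F :=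
  L.comap (F.subtype.restrictScalars ℤ)

/-- The reduced height of a subspace: `covol(F ∩ L)^(1/dim F)`. -/
def Hr (L : Submodule ℤ E) (F : Submodule ℝ E) : ℝ := redH (latIn L F)

/-- A subspace is rational if it is spanned by its intersection with the lattice. -/
def IsRational (L : Submodule ℤ E) (F : Submodule ℝ E) : Prop :=
  Submodule.span ℝ ((L : Set E) ∩ (F : Set E)) = F

/-- `(E, L)` is a Euclidean lattice: `L` is discrete and spans `E` over `ℝ`. -/
def IsLat (L : Submodule ℤ E) : Prop :=
  DiscreteTopology L ∧ Submodule.span ℝ (L : Set E) = ⊤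

/-- Minimal reduced height: infimum of reduced heights of nonzero rational subspaces. -/
def Hmin (L : Submodule ℤ E) : ℝ :=
  sInf {h : ℝ | ∃ F : Submodule ℝ E, F ≠ ⊥ ∧ IsRational L F ∧ h = Hr L F}

/-- Semistability of a Euclidean lattice. -/
def Semistable (L : Submodule ℤ E) : Prop :=
  ∀ F : Submodule ℝ E, F ≠ ⊥ → IsRational L F → redH L ≤ Hr L F

/-- Stability of a Euclidean lattice. -/
def Stable (L : Submodule ℤ E) : Prop :=
  Semistable L ∧ ∀ F : Submodule ℝ E, F ≠ ⊥ → F ≠ ⊤ → IsRational L F → redH L < Hr L F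

/-- The quotient lattice of `(E, L)` by a subspace `F`: the image of `L` under the
orthogonal projection of `E` onto `Fᗮ`. -/
def quotLat [FiniteDimensional ℝ E] (L : Submodule ℤ E) (F : Submodule ℝ E) :
    Submodule ℤ Fᗮ :=
  L.map ((Submodule.orthogonalProjectionOnto Fᗮ : E →ₗ[ℝ] Fᗮ).restrictScalars ℤ)

/-- For subspaces `F ≤ F'`, the successive quotient lattice: the image of `F' ∩ L` under the
orthogonal projection of `F'` onto the orthogonal complement of `F` inside `F'`. -/
def succQuot [FiniteDimensional ℝ E] (L : Submodule ℤ E) (F F' : Submodule ℝ E) :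
    Submodule ℤ ((F.comap F'.subtype)ᗮ) :=
  quotLat (latIn L F') (F.comap F'.subtype)

/-- A GS-flag of `(E, L)`. -/
def IsGSFlag [FiniteDimensional ℝ E] (L : Submodule ℤ E) {ℓ : ℕ}
    (C : Fin (ℓ + 1) → Submodule ℝ E) : Prop :=
  C 0 = ⊥ ∧ C (Fin.last ℓ) = ⊤ ∧
  (∀ i : Fin ℓ, C i.castSucc < C i.succ) ∧
  (∀ i, IsRational L (C i)) ∧
  (∀ i : Fin ℓ, Semistable (succQuot L (C i.castSucc) (C i.succ))) ∧
  (∀ i j : Fin ℓ, i < j →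
    redH (succQuot L (C i.castSucc) (C i.succ)) < redH (succQuot L (C j.castSucc) (C j.succ)))

/-- The dual lattice `L* = {y : ⟪x, y⟫ ∈ ℤ for all x ∈ L}`. -/
def dualLat (L : Submodule ℤ E) : Submodule ℤ E where
  carrier := {y | ∀ x ∈ L, ∃ n : ℤ, (inner ℝ x y : ℝ) = n}
  zero_mem' := fun x _ => ⟨0, by simp⟩
  add_mem' := by
    intro a b ha hb x hx
    obtain ⟨m, hm⟩ := ha x hx
    obtain ⟨n, hn⟩ := hb x hx
    exact ⟨m + n, by rw [inner_add_right, hm, hn]; push_cast; ring⟩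
  smul_mem' := by
    intro z y hy x hx
    obtain ⟨n, hn⟩ := hy x hx
    refine ⟨z * n, ?_⟩
    rw [← Int.cast_smul_eq_zsmul ℝ, real_inner_smul_right, hn]
    push_cast; ring

/-- `(E, L)` is isodual via the similarity `τ`. -/
def IsIsodual (L : Submodule ℤ E) (τ : E →ₗ[ℝ] E) : Prop :=
  (∃ α : ℝ, 0 < α ∧ ∀ x y : E, (inner ℝ (τ x) (τ y) : ℝ) = α * inner ℝ x y) ∧
  L.map (τ.restrictScalars ℤ) = dualLat L

/-- The bilinear form `b_τ(x, y) = ⟪τ x, y⟫` associated with an isoduality. -/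
def bform (τ : E →ₗ[ℝ] E) (x y : E) : ℝ := inner ℝ (τ x) y

/-- `b` has signature `s`: there is a `b`-orthogonal basis with `p - q = s`. -/
def HasSignature (b : E → E → ℝ) (s : ℤ) : Prop :=
  ∃ (n : ℕ) (v : Basis (Fin n) ℝ E),
    (∀ i j, i ≠ j → b (v i) (v j) = 0) ∧
    s = ((Finset.univ.filter fun i => 0 < b (v i) (v i)).card : ℤ) -
        ((Finset.univ.filter fun i => b (v i) (v i) < 0).card : ℤ)

/-- The destabilizing subspace of `(E, L)`. -/
def IsDestabilizing (L : Submodule ℤ E) (F : Submodule ℝ E) : Prop :=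
  F ≠ ⊥ ∧ IsRational L F ∧ Hr L F = Hmin L ∧
  ∀ F' : Submodule ℝ E, F' ≠ ⊥ → IsRational L F' → Hr L F' = Hmin L → F' ≤ F

/-- `(G, t)` is a realization of the tensor product of the inner product spaces `E` and `F`:
`t` induces a linear isomorphism `E ⊗ F ≃ G` and
`⟪t x y, t x' y'⟫ = ⟪x, x'⟫ * ⟪y, y'⟫` on pure tensors. -/
def IsTensor {F G : Type*} [NormedAddCommGroup F] [InnerProductSpace ℝ F]
    [NormedAddCommGroup G] [InnerProductSpace ℝ G] (t : E →ₗ[ℝ] F →ₗ[ℝ] G) : Prop :=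
  Function.Bijective (TensorProduct.lift t) ∧
  ∀ (x x' : E) (y y' : F),
    (inner ℝ (t x y) (t x' y') : ℝ) = (inner ℝ x x' : ℝ) * (inner ℝ y y' : ℝ)

/-- The tensor product lattice `L·M`: the additive subgroup generated by pure tensors. -/
def tensorLat {F G : Type*} [NormedAddCommGroup F] [InnerProductSpace ℝ F]
    [NormedAddCommGroup G] [InnerProductSpace ℝ G] (t : E →ₗ[ℝ] F →ₗ[ℝ] G)
    (L : Submodule ℤ E) (M : Submodule ℤ F) : Submodule ℤ G :=
  Submodule.span ℤ (Set.image2 (fun x y => t x y) (L : Set E) (M : Set F))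

/-- `g` is an automorphism of the Euclidean lattice `(E, L)`. -/
def IsAut (L : Submodule ℤ E) (g : E ≃ₗ[ℝ] E) : Prop :=
  (∀ x, x ∈ L ↔ g x ∈ L) ∧ ∀ x y : E, (inner ℝ (g x) (g y) : ℝ) = inner ℝ x y

/-- The direct product lattice `L × L'` inside `WithLp 2 (E × E')`. -/
def prodLat {E' : Type*} [NormedAddCommGroup E'] [InnerProductSpace ℝ E']
    (L : Submodule ℤ E) (L' : Submodule ℤ E') : Submodule ℤ (WithLp 2 (E × E')) :=
  (L.prod L').comap (((WithLp.linearEquiv 2 ℝ (E × E')).restrictScalars ℤ) : WithLp 2 (E × E') →ₗ[ℤ] E × E')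


theorem one_le_det_one_add {n : Type*} [Fintype n] [DecidableEq n] {P : Matrix n n ℝ}
    (hP : P.PosSemidef) : 1 ≤ (1 + P).det := by
  have hH : (1 + P).IsHermitian := (Matrix.isHermitian_one).add hP.1
  rw [hH.det_eq_prod_eigenvalues]
  have key : ∀ i, 1 ≤ hH.eigenvalues i := by
    intro i
    rw [hH.eigenvalues_eq]
    rw [Matrix.add_mulVec, dotProduct_add, Matrix.one_mulVec]
    have h1 : (star ((hH.eigenvectorBasis i).ofLp) ⬝ᵥ ((hH.eigenvectorBasis i).ofLp) : ℝ) = 1 := by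
      have h2 := hH.eigenvectorBasis.inner_eq_one i
      rw [EuclideanSpace.inner_eq_star_dotProduct] at h2
      rw [dotProduct_comm]
      exact h2
    have h3 := hP.dotProduct_mulVec_nonneg ((hH.eigenvectorBasis i).ofLp)
    rw [h1]
    simpa using h3
  have : ∀ s : Finset n, (1 : ℝ) ≤ ∏ i ∈ s, hH.eigenvalues i := fun s =>
    s.prod_induction _ (fun x => (1 : ℝ) ≤ x) (fun a b ha hb => one_le_mul_of_one_le_of_one_le ha hb)
      le_rfl (fun i _ => key i)
  simpa using this Finset.univ

theorem det_le_det_add {n : Type*} [Fintype n] [DecidableEq n] {P Q : Matrix n n ℝ}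
    (hP : P.PosSemidef) (hQ : Q.PosDef) : Q.det ≤ (P + Q).det := by
  obtain ⟨B, hB⟩ : ∃ B : Matrix n n ℝ, Q = B.conjTranspose * B := by
    open scoped MatrixOrder in
    exact CStarAlgebra.nonneg_iff_eq_star_mul_self.mp hQ.posSemidef.nonneg
  subst hB
  have hu : IsUnit B.det := by
    have := hQ.det_pos
    rw [Matrix.det_mul] at this
    exact isUnit_iff_ne_zero.mpr (right_ne_zero_of_mul this.ne')
  have hP' : ((B⁻¹).conjTranspose * P * B⁻¹).PosSemidef := hP.conjTranspose_mul_mul_same _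
  have h1 := one_le_det_one_add hP'
  have h2 : P + B.conjTranspose * B
      = B.conjTranspose * (1 + (B⁻¹).conjTranspose * P * B⁻¹) * B := by
    have e1 : B⁻¹ * B = 1 := Matrix.nonsing_inv_mul _ hu
    have e2 : B.conjTranspose * (B⁻¹).conjTranspose = 1 := by
      rw [← Matrix.conjTranspose_mul, e1, Matrix.conjTranspose_one]
    calc P + B.conjTranspose * B = (B.conjTranspose * (B⁻¹).conjTranspose) * P * (B⁻¹ * B)
          + B.conjTranspose * B := by rw [e1, e2]; simp
      _ = _ := by noncomm_ring
  rw [h2, Matrix.det_mul, Matrix.det_mul, Matrix.det_mul]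
  have h3 : 0 ≤ B.conjTranspose.det * B.det := by
    have := hQ.det_pos.le
    rwa [Matrix.det_mul] at this
  nlinarith

theorem gram_int_det {ι G : Type*} [Fintype ι] [DecidableEq ι] [NormedAddCommGroup G]
    [InnerProductSpace ℝ G] (v w : ι → G) (T : Matrix ι ι ℤ)
    (h : ∀ i, w i = ∑ j, T i j • v j) :
    (Matrix.gram ℝ w).det = ((T.det : ℤ) : ℝ) ^ 2 * (Matrix.gram ℝ v).det := by
  have : Matrix.gram ℝ w = (T.map (Int.cast : ℤ → ℝ)) * Matrix.gram ℝ v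
      * (T.map (Int.cast : ℤ → ℝ)).transpose := by
    ext i j
    simp only [Matrix.gram_apply, h, Matrix.mul_apply, Matrix.transpose_apply, Matrix.map_apply,
      ← Int.cast_smul_eq_zsmul ℝ, sum_inner, inner_sum, real_inner_smul_left,
      real_inner_smul_right, Finset.sum_mul]
    refine Finset.sum_congr rfl fun a _ => Finset.sum_congr rfl fun b _ => by ring
  have hd : (T.map (Int.cast : ℤ → ℝ)).det = ((T.det : ℤ) : ℝ) :=
    ((Int.castRingHom ℝ).map_det T).symm
  rw [this, Matrix.det_mul, Matrix.det_mul, Matrix.det_transpose, hd]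
  ring

/-- Every independent family in the lattice has Gram determinant at least `c^(2n)`. -/
def Pc {G : Type*} [NormedAddCommGroup G] [InnerProductSpace ℝ G] (Λ : Submodule ℤ G)
    (c : ℝ) : Prop :=
  ∀ (n : ℕ) (v : Fin n → G), (∀ i, v i ∈ Λ) → LinearIndependent ℤ v →
    c ^ (2 * n) ≤ (Matrix.gram ℝ v).det

theorem gram_reindex {ι κ G : Type*} [Fintype ι] [DecidableEq ι] [Fintype κ] [DecidableEq κ]
    [NormedAddCommGroup G] [InnerProductSpace ℝ G] (v : ι → G) (e : κ ≃ ι) :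
    (Matrix.gram ℝ (v ∘ e)).det = (Matrix.gram ℝ v).det := by
  have : Matrix.gram ℝ (v ∘ e) = (Matrix.gram ℝ v).submatrix e e := by
    ext i j; simp [Matrix.gram_apply]
  rw [this, Matrix.det_submatrix_equiv_self]

theorem block_det {p q G : Type*} [Fintype p] [DecidableEq p] [Fintype q] [DecidableEq q]
    [NormedAddCommGroup G] [InnerProductSpace ℝ G] (k : p → G) (a b : q → G)
    (hk : ∀ i j, inner ℝ (k i) (b j) = 0) (hab : ∀ i j, inner ℝ (a i) (b j) = 0)
    (hkpos : 0 < (Matrix.gram ℝ k).det) (hbpos : 0 < (Matrix.gram ℝ b).det) :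
    (Matrix.gram ℝ k).det * (Matrix.gram ℝ b).det
      ≤ (Matrix.gram ℝ (Sum.elim k (fun j => a j + b j))).det := by
  set K := Matrix.gram ℝ k with hK
  set X : Matrix p q ℝ := Matrix.of fun i j => inner ℝ (k i) (a j) with hX
  have hba : ∀ i j, inner ℝ (b i) (a j) = 0 := fun i j => by rw [real_inner_comm]; exact hab j i
  have hbk : ∀ i j, inner ℝ (b i) (k j) = 0 := fun i j => by rw [real_inner_comm]; exact hk j i
  have e1 : Matrix.gram ℝ (Sum.elim k (fun j => a j + b j))
      = Matrix.fromBlocks K X X.conjTranspose (Matrix.gram ℝ a + Matrix.gram ℝ b) := by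
    ext i j
    rcases i with i | i <;> rcases j with j | j <;>
      simp [Matrix.gram_apply, hK, hX, inner_add_left, inner_add_right, hk, hab, hba, hbk,
        real_inner_comm]
  have e2 : Matrix.gram ℝ (Sum.elim k a)
      = Matrix.fromBlocks K X X.conjTranspose (Matrix.gram ℝ a) := by
    ext i j
    rcases i with i | i <;> rcases j with j | j <;>
      simp [Matrix.gram_apply, hK, hX, real_inner_comm]
  have hKp : K.PosDef := (Matrix.posSemidef_gram ℝ k).posDef_iff_det_ne_zero.mpr hkpos.ne'
  have hBp : (Matrix.gram ℝ b).PosDef :=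
    (Matrix.posSemidef_gram ℝ b).posDef_iff_det_ne_zero.mpr hbpos.ne'
  let _ : Invertible K := K.invertibleOfIsUnitDet (isUnit_iff_ne_zero.mpr hkpos.ne')
  have hS : (Matrix.gram ℝ a - X.conjTranspose * K⁻¹ * X).PosSemidef := by
    rw [← Matrix.PosDef.fromBlocks₁₁ X _ hKp, ← e2]
    exact Matrix.posSemidef_gram ℝ _
  rw [e1, Matrix.det_fromBlocks₁₁]
  refine mul_le_mul_of_nonneg_left ?_ hkpos.le
  have := det_le_det_add hS hBp
  rw [Matrix.invOf_eq_nonsing_inv]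
  rw [← add_sub_right_comm] at this
  exact this

theorem Pc_sup {G : Type*} [NormedAddCommGroup G] [InnerProductSpace ℝ G] (Λ₁ Λ₂ : Submodule ℤ G)
    (c : ℝ) (hc : 0 ≤ c) (horth : ∀ x ∈ Λ₁, ∀ y ∈ Λ₂, inner ℝ x y = 0)
    (h1 : Pc Λ₁ c) (h2 : Pc Λ₂ c) : Pc (Λ₁ ⊔ Λ₂) c := by
  intro n v hv hli
  rcases hc.eq_or_lt with hc0 | hcpos
  · subst hc0
    rcases Nat.eq_zero_or_pos n with rfl | hn
    · simp
    · rw [zero_pow (by omega)]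
      exact (Matrix.posSemidef_gram ℝ v).det_nonneg
  have hv' : ∀ i, ∃ a b, a ∈ Λ₁ ∧ b ∈ Λ₂ ∧ a + b = v i := by
    intro i
    obtain ⟨a, ha, b, hb, hab⟩ := Submodule.mem_sup.mp (hv i)
    exact ⟨a, b, ha, hb, hab⟩
  choose a b ha hb hab using hv'
  let fa : (Fin n → ℤ) →ₗ[ℤ] G := Fintype.linearCombination ℤ a
  let fb : (Fin n → ℤ) →ₗ[ℤ] G := Fintype.linearCombination ℤ b
  let fv : (Fin n → ℤ) →ₗ[ℤ] G := Fintype.linearCombination ℤ v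
  have hfv : ∀ z, fv z = fa z + fb z := by
    intro z
    simp only [fv, fa, fb, Fintype.linearCombination_apply, ← hab, smul_add,
      Finset.sum_add_distrib]
  have hfa : ∀ z, fa z ∈ Λ₁ := fun z => by
    simp only [fa, Fintype.linearCombination_apply]
    exact Submodule.sum_mem _ fun i _ => Submodule.smul_mem _ _ (ha i)
  have hfb : ∀ z, fb z ∈ Λ₂ := fun z => by
    simp only [fb, Fintype.linearCombination_apply]
    exact Submodule.sum_mem _ fun i _ => Submodule.smul_mem _ _ (hb i)
  have hinj : Function.Injective fv := hli.fintypeLinearCombination_injective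
  let _ : Module ℚ G := Module.compHom G (algebraMap ℚ ℝ)
  have : IsAddTorsionFree G := .of_module_rat _
  have : Module.Free ℤ (LinearMap.range fb) := inferInstance
  let bK := Module.finBasis ℤ (LinearMap.ker fb)
  let bR := Module.finBasis ℤ (LinearMap.range fb)
  let bQ := bR.map fb.quotKerEquivRange.symm
  let B := Basis.sumQuot bK bQ
  have hBl : ∀ i, B (Sum.inl i) = bK i := fun i => Basis.sumQuot_inl bK bQ i
  have hBr : ∀ j, fb (B (Sum.inr j)) = bR j := by
    intro j
    have h := Basis.sumQuot_inr bK bQ j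
    have h' := congrArg (fun t => ((fb.quotKerEquivRange t : LinearMap.range fb) : G)) h
    simp only [bQ, Basis.map_apply, LinearEquiv.apply_symm_apply] at h'
    rw [← h']
    rfl
  let e : (Fin (finrank ℤ (LinearMap.ker fb)) ⊕ Fin (finrank ℤ (LinearMap.range fb))) ≃ Fin n :=
    B.indexEquiv (Pi.basisFun ℤ (Fin n))
  have hcard : finrank ℤ (LinearMap.ker fb) + finrank ℤ (LinearMap.range fb) = n := by
    simpa using Fintype.card_congr e
  -- block vectors
  set k : Fin (finrank ℤ (LinearMap.ker fb)) → G := fun i => fv (B (Sum.inl i)) with hk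
  set a' : Fin (finrank ℤ (LinearMap.range fb)) → G := fun j => fa (B (Sum.inr j)) with ha'
  set b' : Fin (finrank ℤ (LinearMap.range fb)) → G := fun j => fb (B (Sum.inr j)) with hb'
  have hkmem : ∀ i, k i ∈ Λ₁ := by
    intro i
    have h0 : fb (B (Sum.inl i)) = 0 := by rw [hBl]; exact (bK i).2
    simp only [hk, hfv, h0, add_zero]
    exact hfa _
  have hkli : LinearIndependent ℤ k := by
    have := (B.linearIndependent.comp Sum.inl Sum.inl_injective).map' fv
      (LinearMap.ker_eq_bot.mpr hinj)
    exact this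
  have hbli : LinearIndependent ℤ b' := by
    have h := bR.linearIndependent.map' (LinearMap.range fb).subtype (Submodule.ker_subtype _)
    have h2 : b' = (LinearMap.range fb).subtype ∘ bR := funext hBr
    rw [h2]
    exact h
  have hdk := h1 _ k hkmem hkli
  have hdb := h2 _ b' (fun j => hfb _) hbli
  have hblock := block_det k a' b' (fun i j => horth _ (hkmem i) _ (hfb _))
    (fun i j => horth _ (hfa _) _ (hfb _)) (lt_of_lt_of_le (by positivity) hdk)
    (lt_of_lt_of_le (by positivity) hdb)
  -- compare with `v`
  let B' : Basis (Fin n) ℤ (Fin n → ℤ) := B.reindex e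
  have hw : (Sum.elim k (fun j => a' j + b' j)) = (fun i => fv (B' i)) ∘ e := by
    funext s
    rcases s with i | j
    · simp [B', hk]
    · simp [B', ha', hb', hfv]
  have hdet : (Matrix.gram ℝ (fun i => fv (B' i))).det = (Matrix.gram ℝ v).det := by
    have h := gram_int_det v (fun i => fv (B' i)) (Matrix.of fun i j => B' i j) (fun i => by
      simp [fv, Fintype.linearCombination_apply])
    have hu : IsUnit (Matrix.of fun i j => B' i j).det := by
      have h3 := (Pi.basisFun ℤ (Fin n)).isUnit_det B'
      rw [Basis.det_apply, ← Matrix.det_transpose] at h3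
      have h5 : (Matrix.of fun i j => B' i j)
          = ((Pi.basisFun ℤ (Fin n)).toMatrix B').transpose := by
        ext i j
        simp [Basis.toMatrix_apply]
      rw [h5]
      exact h3
    rcases Int.isUnit_iff.mp hu with h4 | h4 <;> rw [h, h4] <;> simp
  rw [hw, gram_reindex, hdet] at hblock
  calc c ^ (2 * n) = c ^ (2 * finrank ℤ (LinearMap.ker fb)) * c ^ (2 * finrank ℤ (LinearMap.range fb)) := by
        rw [← pow_add]; congr 1; omega
    _ ≤ _ := mul_le_mul hdk hdb (by positivity) (le_trans (by positivity) hdk)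
    _ ≤ _ := hblock

theorem Pc_bot {G : Type*} [NormedAddCommGroup G] [InnerProductSpace ℝ G] (c : ℝ) :
    Pc (⊥ : Submodule ℤ G) c := by
  intro n v hv hli
  rcases Nat.eq_zero_or_pos n with rfl | hn
  · simp
  · exact absurd ((Submodule.mem_bot ℤ).mp (hv ⟨0, hn⟩)) (hli.ne_zero _)

theorem Pc_finset_sup {ι G : Type*} [NormedAddCommGroup G] [InnerProductSpace ℝ G]
    (Λ : ι → Submodule ℤ G) (c : ℝ) (hc : 0 ≤ c)
    (horth : ∀ i j, i ≠ j → ∀ x ∈ Λ i, ∀ y ∈ Λ j, inner ℝ x y = 0)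
    (h : ∀ i, Pc (Λ i) c) (s : Finset ι) : Pc (⨆ i ∈ s, Λ i) c := by
  classical
  induction s using Finset.induction_on with
  | empty => simpa using Pc_bot c
  | insert i s his ih =>
    rw [Finset.iSup_insert]
    refine Pc_sup _ _ c hc ?_ (h i) ih
    intro x hx y hy
    let O : Submodule ℤ G :=
      { carrier := {y | inner ℝ x y = 0}
        zero_mem' := by simp
        add_mem' := by
          intro p q hp hq
          simp only [Set.mem_ofPred_eq] at *
          rw [inner_add_right, hp, hq, add_zero]
        smul_mem' := by
          intro z p hp
          simp only [Set.mem_ofPred_eq] at *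
          rw [← Int.cast_smul_eq_zsmul ℝ, real_inner_smul_right, hp, mul_zero] }
    have hle : (⨆ j ∈ s, Λ j) ≤ O := by
      refine iSup₂_le fun j hj y hy => ?_
      exact horth i j (fun hij => his (hij ▸ hj)) x hx y hy
    exact hle hy

theorem Pc_map {F G : Type*} [NormedAddCommGroup F] [InnerProductSpace ℝ F]
    [NormedAddCommGroup G] [InnerProductSpace ℝ G] (M : Submodule ℤ F) (f : F →ₗ[ℝ] G)
    (β c : ℝ) (hβ : 0 < β) (hf : ∀ x y, inner ℝ (f x) (f y) = β * inner ℝ x y)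
    (h : Pc M c) : Pc (M.map (f.restrictScalars ℤ)) (√β * c) := by
  intro n v hv hli
  choose m hm hmv using fun i => Submodule.mem_map.mp (hv i)
  have hv' : v = (f.restrictScalars ℤ) ∘ m := by funext i; exact (hmv i).symm
  have hmli : LinearIndependent ℤ m := by
    rw [hv'] at hli
    exact LinearIndependent.of_comp _ hli
  have hg : Matrix.gram ℝ v = β • Matrix.gram ℝ m := by
    ext i j
    simp [Matrix.gram_apply, hv', hf]
  rw [hg, Matrix.det_smul, Fintype.card_fin, mul_pow, pow_mul √β, Real.sq_sqrt hβ.le]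
  exact mul_le_mul_of_nonneg_left (h n m hm hmli) (by positivity)

theorem li_real {G : Type*} [NormedAddCommGroup G] [InnerProductSpace ℝ G]
    [FiniteDimensional ℝ G] (Λ : Submodule ℤ G) (hd : DiscreteTopology Λ) {n : ℕ} (v : Fin n → G)
    (hv : ∀ i, v i ∈ Λ) (hli : LinearIndependent ℤ v) : LinearIndependent ℝ v := by
  have hle : Submodule.span ℤ (Set.range v) ≤ Λ := by
    rw [Submodule.span_le]; rintro _ ⟨i, rfl⟩; exact hv i
  have hd' : DiscreteTopology (Submodule.span ℤ (Set.range v)) :=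
    DiscreteTopology.of_subset (s := (Λ : Set G)) hd hle
  have h := Real.finrank_eq_int_finrank_of_discrete hd'
  have h2 : Set.finrank ℤ (Set.range v) = n := by
    have := finrank_span_eq_card hli
    simpa [Set.finrank] using this
  rw [linearIndependent_iff_card_eq_finrank_span]
  simp [h, h2]

theorem latIn_discrete {G : Type*} [NormedAddCommGroup G] [InnerProductSpace ℝ G]
    (Λ : Submodule ℤ G) (hd : DiscreteTopology Λ) (F : Submodule ℝ G) :
    DiscreteTopology (latIn Λ F) := by
  have := hd
  exact DiscreteTopology.preimage_of_continuous_injective (Λ : Set G)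
    (f := (Subtype.val : F → G)) continuous_subtype_val Subtype.val_injective

theorem latIn_span {G : Type*} [NormedAddCommGroup G] [InnerProductSpace ℝ G]
    (Λ : Submodule ℤ G) (F : Submodule ℝ G) (hF : IsRational Λ F) :
    Submodule.span ℝ (latIn Λ F : Set F) = ⊤ := by
  apply Submodule.map_injective_of_injective F.injective_subtype
  rw [Submodule.map_span, Submodule.map_top, Submodule.range_subtype]
  conv_rhs => rw [← hF]
  congr 1
  ext x
  constructor
  · rintro ⟨y, hy, rfl⟩
    exact ⟨hy, y.2⟩
  · rintro ⟨hx, hxF⟩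
    exact ⟨⟨x, hxF⟩, hx, rfl⟩

theorem hr_spec {G : Type*} [NormedAddCommGroup G] [InnerProductSpace ℝ G]
    [FiniteDimensional ℝ G] (Λ : Submodule ℤ G) (hd : DiscreteTopology Λ) (F : Submodule ℝ G)
    (hF : IsRational Λ F) :
    ∃ (n : ℕ) (b : Fin n → G), n = finrank ℝ F ∧ LinearIndependent ℤ b ∧ (∀ i, b i ∈ Λ) ∧
      (∀ x ∈ Λ, x ∈ F → x ∈ Submodule.span ℤ (Set.range b)) ∧
      Hr Λ F = √((Matrix.gram ℝ b).det) ^ ((n : ℝ)⁻¹) := by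
  have hd' := latIn_discrete Λ hd F
  have hz : IsZLattice ℝ (latIn Λ F) := ⟨latIn_span Λ F hF⟩
  have hfin : Module.Finite ℤ (latIn Λ F) := ZLattice.module_finite ℝ _
  have hfree : Module.Free ℤ (latIn Λ F) := ZLattice.module_free ℝ _
  have h : ∃ n : ℕ, Nonempty (Basis (Fin n) ℤ (latIn Λ F)) :=
    ⟨_, ⟨Module.finBasis ℤ (latIn Λ F)⟩⟩
  have hcov : covol (latIn Λ F) = √((Matrix.gram ℝ
      (fun i => ((h.choose_spec.some i : latIn Λ F) : F))).det) := by
    unfold covol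
    rw [dif_pos h]
    rfl
  generalize h.choose_spec.some = B at hcov
  have hn : h.choose = finrank ℝ F := by
    rw [← ZLattice.rank ℝ (latIn Λ F), finrank_eq_card_basis B, Fintype.card_fin]
  refine ⟨h.choose, fun i => ((B i : F) : G), hn, ?_, fun i => (B i).2, ?_, ?_⟩
  · have h1 := B.linearIndependent.map' (latIn Λ F).subtype (Submodule.ker_subtype _)
    have h2 := h1.map' (F.subtype.restrictScalars ℤ)
      (LinearMap.ker_eq_bot.mpr Subtype.val_injective)
    exact h2
  · intro x hx hxF
    have h1 := B.sum_repr ⟨⟨x, hxF⟩, hx⟩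
    have h2 := congrArg (fun t : latIn Λ F => ((t : F) : G)) h1
    simp only [AddSubmonoidClass.coe_finsetSum, Submodule.coe_smul_of_tower] at h2
    rw [← h2]
    exact Submodule.sum_mem _ fun i _ => Submodule.smul_mem _ _ (Submodule.subset_span ⟨i, rfl⟩)
  · unfold Hr redH
    rw [hcov, ← hn]
    rfl

theorem Hr_nonneg {G : Type*} [NormedAddCommGroup G] [InnerProductSpace ℝ G]
    (Λ : Submodule ℤ G) (F : Submodule ℝ G) : 0 ≤ Hr Λ F := by
  unfold Hr redH
  apply Real.rpow_nonneg
  unfold covol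
  split_ifs
  · exact Real.sqrt_nonneg _
  · exact le_rfl

theorem Hmin_nonneg {G : Type*} [NormedAddCommGroup G] [InnerProductSpace ℝ G]
    (Λ : Submodule ℤ G) : 0 ≤ Hmin Λ := by
  apply Real.sInf_nonneg
  rintro _ ⟨F, -, -, rfl⟩
  exact Hr_nonneg Λ F

theorem rpow_helper (d : ℝ) (hd : 0 ≤ d) (n : ℕ) (hn : n ≠ 0) :
    (√d ^ ((n : ℝ)⁻¹)) ^ (2 * n) = d := by
  rw [mul_comm, pow_mul, Real.rpow_inv_natCast_pow (Real.sqrt_nonneg _) hn, Real.sq_sqrt hd]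

theorem Pc_Hmin {G : Type*} [NormedAddCommGroup G] [InnerProductSpace ℝ G]
    [FiniteDimensional ℝ G] (Λ : Submodule ℤ G) (hd : DiscreteTopology Λ) : Pc Λ (Hmin Λ) := by
  intro n v hv hli
  rcases Nat.eq_zero_or_pos n with rfl | hn
  · simp
  have hliR := li_real Λ hd v hv hli
  set F := Submodule.span ℝ (Set.range v) with hFdef
  have hvF : ∀ i, v i ∈ F := fun i => Submodule.subset_span ⟨i, rfl⟩
  have hfr : finrank ℝ F = n := by
    have := finrank_span_eq_card hliR
    simpa using this
  have hF : IsRational Λ F := by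
    apply le_antisymm
    · rw [Submodule.span_le]; exact fun x hx => hx.2
    · rw [hFdef, Submodule.span_le]
      rintro _ ⟨i, rfl⟩
      exact Submodule.subset_span ⟨hv i, hvF i⟩
  have hF0 : F ≠ ⊥ := by
    intro h0
    have := hvF ⟨0, hn⟩
    rw [h0, Submodule.mem_bot] at this
    exact hliR.ne_zero _ this
  obtain ⟨m, b, hm, hbli, hbΛ, hbspan, hHr⟩ := hr_spec Λ hd F hF
  rw [hfr] at hm
  subst hm
  have hle : Hmin Λ ≤ Hr Λ F :=
    csInf_le ⟨0, by rintro _ ⟨F, -, -, rfl⟩; exact Hr_nonneg Λ F⟩ ⟨F, hF0, hF, rfl⟩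
  have hT : ∀ i, ∃ T : Fin m → ℤ, ∑ j, T j • b j = v i := fun i =>
    (Submodule.mem_span_range_iff_exists_fun ℤ).mp (hbspan _ (hv i) (hvF i))
  choose T hT using hT
  have hdet := gram_int_det b v (Matrix.of T) (fun i => (hT i).symm)
  have hpos : 0 < (Matrix.gram ℝ v).det := (Matrix.posDef_gram_of_linearIndependent hliR).det_pos
  have hb0 : 0 ≤ (Matrix.gram ℝ b).det := (Matrix.posSemidef_gram ℝ b).det_nonneg
  have hT0 : (Matrix.of T).det ≠ 0 := by
    intro h0
    rw [hdet, h0] at hpos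
    simp at hpos
  have hT1 : (1 : ℝ) ≤ (((Matrix.of T).det : ℤ) : ℝ) ^ 2 := by
    have : (1 : ℤ) ≤ (Matrix.of T).det ^ 2 := by
      have := pow_pos (abs_pos.mpr hT0) 2
      rw [sq_abs] at this
      omega
    exact_mod_cast this
  calc Hmin Λ ^ (2 * m) ≤ Hr Λ F ^ (2 * m) := pow_le_pow_left₀ (Hmin_nonneg Λ) hle _
    _ = (Matrix.gram ℝ b).det := by rw [hHr, rpow_helper _ hb0 _ hn.ne']
    _ ≤ _ := by rw [hdet]; nlinarith

theorem le_Hmin {G : Type*} [NormedAddCommGroup G] [InnerProductSpace ℝ G]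
    [FiniteDimensional ℝ G] (Λ : Submodule ℤ G) (hd : DiscreteTopology Λ)
    (hne : ∃ x ∈ Λ, x ≠ 0) (c : ℝ) (h : Pc Λ c) : c ≤ Hmin Λ := by
  apply le_csInf
  · obtain ⟨x, hx, hx0⟩ := hne
    refine ⟨_, Submodule.span ℝ {x}, ?_, ?_, rfl⟩
    · simpa [Submodule.span_singleton_eq_bot] using hx0
    · apply le_antisymm
      · rw [Submodule.span_le]; exact fun x hx => hx.2
      · rw [Submodule.span_le]
        rintro _ rfl
        exact Submodule.subset_span ⟨hx, Submodule.mem_span_singleton_self _⟩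
  · rintro _ ⟨F, hF0, hF, rfl⟩
    obtain ⟨m, b, hm, hbli, hbΛ, hbspan, hHr⟩ := hr_spec Λ hd F hF
    have hm0 : m ≠ 0 := by
      rw [hm]
      intro h0
      exact hF0 (Submodule.finrank_eq_zero.mp h0)
    have h1 := h m b hbΛ hbli
    have hb0 : 0 ≤ (Matrix.gram ℝ b).det := (Matrix.posSemidef_gram ℝ b).det_nonneg
    rw [← rpow_helper _ hb0 m hm0, ← hHr] at h1
    exact le_of_pow_le_pow_left₀ (by omega) (Hr_nonneg Λ F) h1

theorem ball_numeric (n : ℕ) (h0 : 0 < n) (h4 : n ≤ 4) :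
    (2 : ℝ) ^ n < √2 ^ n * (√Real.pi ^ n / Real.Gamma (n / 2 + 1)) := by
  have hpi := Real.pi_gt_three
  have hs : √2 ^ 2 = 2 := Real.sq_sqrt (by norm_num)
  have hs1 : (1.4 : ℝ) < √2 := by
    rw [Real.lt_sqrt (by norm_num)]; norm_num
  have hp : √Real.pi ^ 2 = Real.pi := Real.sq_sqrt (by positivity)
  have hp0 : 0 < √Real.pi := Real.sqrt_pos.mpr (by positivity)
  have g1 : Real.Gamma (1 / 2 + 1) = √Real.pi / 2 := by
    rw [Real.Gamma_add_one (by norm_num), Real.Gamma_one_half_eq]; ring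
  interval_cases n
  · rw [Nat.cast_one, pow_one, pow_one, pow_one, g1]
    rw [div_div_eq_mul_div, mul_div_cancel_left₀ _ hp0.ne']
    linarith
  · have : Real.Gamma (((2 : ℕ) : ℝ) / 2 + 1) = 1 := by
      norm_num
    rw [this, hs, hp]; linarith
  · have : Real.Gamma (((3 : ℕ) : ℝ) / 2 + 1) = 3 / 2 * (√Real.pi / 2) := by
      rw [← g1, Nat.cast_ofNat, Real.Gamma_add_one (by norm_num)]
      congr 2
      norm_num
    rw [this, pow_succ √2, pow_succ √Real.pi, hs, hp]
    have : Real.pi * √Real.pi / (3 / 2 * (√Real.pi / 2)) = 4 / 3 * Real.pi := by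
      field_simp; norm_num
    rw [this]; nlinarith
  · have : Real.Gamma (((4 : ℕ) : ℝ) / 2 + 1) = 2 := by
      have := Real.Gamma_nat_eq_factorial 2
      norm_num [Nat.factorial] at this ⊢
    rw [this, show (4 : ℕ) = 2 * 2 by norm_num, pow_mul √2, pow_mul √Real.pi, hs, hp]; nlinarith

theorem gram_det_unimodular {E : Type*} [NormedAddCommGroup E] [InnerProductSpace ℝ E]
    {n : ℕ} (L : Submodule ℤ E) (b : Basis (Fin n) ℤ L)
    (hli : LinearIndependent ℝ (fun i => (b i : E))) (s : ℝ) (hs : 0 < s)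
    (hint : ∀ x ∈ L, ∀ y ∈ L, ∃ z : ℤ, s * inner ℝ x y = z)
    (hdual : ∀ y, (∀ x ∈ L, ∃ z : ℤ, s * inner ℝ x y = z) → y ∈ L) :
    s ^ n * (Matrix.gram ℝ (fun i => (b i : E))).det = 1 := by
  set g := Matrix.gram ℝ (fun i => (b i : E)) with hg
  have hgp : 0 < g.det := (Matrix.posDef_gram_of_linearIndependent hli).det_pos
  have hdet : (s • g).det = s ^ n * g.det := by rw [Matrix.det_smul, Fintype.card_fin]
  have hpos : 0 < (s • g).det := by rw [hdet]; positivity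
  choose B hB using fun i j => hint (b i) (b i).2 (b j) (b j).2
  have hBg : (Matrix.of B).map (Int.cast : ℤ → ℝ) = s • g := by
    ext i j
    simp [hg, Matrix.gram_apply, hB]
  let y : Fin n → E := fun i => ∑ j, (s • g)⁻¹ i j • (b j : E)
  have hy : ∀ i k, s * inner ℝ (b k : E) (y i) = if i = k then 1 else 0 := by
    intro i k
    have h1 : ((s • g)⁻¹ * (s • g)) i k = (1 : Matrix (Fin n) (Fin n) ℝ) i k := by
      rw [Matrix.nonsing_inv_mul _ (isUnit_iff_ne_zero.mpr hpos.ne')]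
    rw [Matrix.one_apply, Matrix.mul_apply] at h1
    rw [← h1]
    simp only [y, inner_sum, real_inner_smul_right, Finset.mul_sum, Matrix.smul_apply, hg,
      Matrix.gram_apply, smul_eq_mul]
    refine Finset.sum_congr rfl fun j _ => ?_
    rw [real_inner_comm (b j : E)]; ring
  have hrepr : ∀ x : L, (x : E) = ∑ k, b.repr x k • (b k : E) := by
    intro x
    have h2 := congrArg (fun t : L => (t : E)) (b.sum_repr x)
    simp only [AddSubmonoidClass.coe_finsetSum, Submodule.coe_smul_of_tower] at h2
    exact h2.symm
  have hyL : ∀ i, y i ∈ L := by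
    intro i
    apply hdual
    intro x hx
    refine ⟨b.repr ⟨x, hx⟩ i, ?_⟩
    have h5 : ∀ w : Fin n → ℤ, s * inner ℝ (∑ k, w k • (b k : E)) (y i) = w i := by
      intro w
      simp only [sum_inner, ← Int.cast_smul_eq_zsmul ℝ, real_inner_smul_left, Finset.mul_sum]
      have : ∀ k, s * ((w k : ℝ) * inner ℝ (b k : E) (y i)) = if i = k then (w k : ℝ) else 0 := by
        intro k
        rw [mul_left_comm, hy]; simp
      simp only [this]
      simp
    exact (congrArg (fun t => s * inner ℝ t (y i)) (hrepr ⟨x, hx⟩)).trans (h5 _)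
  let C : Matrix (Fin n) (Fin n) ℤ := Matrix.of fun i j => b.repr ⟨y i, hyL i⟩ j
  have hCB : C.map (Int.cast : ℤ → ℝ) * (Matrix.of B).map (Int.cast : ℤ → ℝ) = 1 := by
    rw [hBg]
    ext i k
    rw [Matrix.one_apply, ← hy i k, Matrix.mul_apply]
    have h3 := hrepr ⟨y i, hyL i⟩
    simp only at h3
    conv_rhs => rw [h3]
    simp only [inner_sum, ← Int.cast_smul_eq_zsmul ℝ, real_inner_smul_right, Finset.mul_sum,
      Matrix.map_apply, C, Matrix.of_apply, Matrix.smul_apply, hg, Matrix.gram_apply, smul_eq_mul]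
    refine Finset.sum_congr rfl fun j _ => ?_
    rw [real_inner_comm (b j : E)]; ring
  have hcast : ∀ T : Matrix (Fin n) (Fin n) ℤ,
      (T.map (Int.cast : ℤ → ℝ)).det = ((T.det : ℤ) : ℝ) := fun T =>
    ((Int.castRingHom ℝ).map_det T).symm
  have hdd := congrArg Matrix.det hCB
  rw [Matrix.det_mul, hcast, hcast, Matrix.det_one] at hdd
  have hdd' : C.det * (Matrix.of B).det = 1 := by exact_mod_cast hdd
  have hBdet : ((((Matrix.of B).det : ℤ)) : ℝ) = s ^ n * g.det := by
    rw [← hcast, hBg, hdet]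
  have hBpos : 0 < (Matrix.of B).det := by
    rw [← hdet] at hBdet
    rw [← hBdet] at hpos
    exact_mod_cast hpos
  have hB1 : (Matrix.of B).det = 1 :=
    Int.eq_one_of_mul_eq_one_left hBpos.le hdd'
  rw [← hBdet, hB1]; simp

theorem exists_unit {E : Type*} [NormedAddCommGroup E] [InnerProductSpace ℝ E]
    [FiniteDimensional ℝ E] (hpos : 0 < finrank ℝ E) (h4 : finrank ℝ E ≤ 4) (L : Submodule ℤ E)
    (hd : DiscreteTopology L) (hspan : Submodule.span ℝ (L : Set E) = ⊤) (s : ℝ) (hs : 0 < s)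
    (hint : ∀ x ∈ L, ∀ y ∈ L, ∃ z : ℤ, s * inner ℝ x y = z)
    (hdual : ∀ y, (∀ x ∈ L, ∃ z : ℤ, s * inner ℝ x y = z) → y ∈ L) :
    ∃ e ∈ L, s * inner ℝ e e = 1 := by
  let _ : MeasurableSpace E := borel E
  have : BorelSpace E := ⟨rfl⟩
  have hz : IsZLattice ℝ L := ⟨hspan⟩
  have hfin : Module.Finite ℤ L := ZLattice.module_finite ℝ _
  have hfree : Module.Free ℤ L := ZLattice.module_free ℝ _
  have hrk : finrank ℤ L = finrank ℝ E := ZLattice.rank ℝ L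
  have : Nontrivial E := Module.finrank_pos_iff.mp hpos
  set n := finrank ℝ E with hn
  let b : Basis (Fin n) ℤ L := (Module.finBasis ℤ L).reindex (finCongr hrk)
  let bR := b.ofZLatticeBasis ℝ L
  have hbR : ∀ i, bR i = (b i : E) := fun i => Basis.ofZLatticeBasis_apply ℝ L b i
  have hbR' : (bR : Fin n → E) = fun i => (b i : E) := funext hbR
  have hg := gram_det_unimodular L b (hbR' ▸ bR.linearIndependent) s hs hint hdual
  let o : OrthonormalBasis (Fin n) ℝ E := stdOrthonormalBasis ℝ E
  set D := |o.toBasis.det bR| with hD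
  have hD2 : D ^ 2 = (Matrix.gram ℝ (fun i => (b i : E))).det := by
    rw [hD, sq_abs, Matrix.gram_eq_conjTranspose_mul o, Basis.det_apply, Matrix.det_mul, hbR',
      Matrix.det_conjTranspose]
    have h6 : o.toBasis.toMatrix (fun i => (b i : E))
        = Matrix.of fun i j => (o.repr (b j : E)).ofLp i := by
      ext i j
      simp [Basis.toMatrix_apply]
    rw [h6]
    simp [sq]
  have hvol : MeasureTheory.volume (ZSpan.fundamentalDomain bR) = ENNReal.ofReal D := by
    rw [ZSpan.measure_fundamentalDomain bR MeasureTheory.volume o.toBasis,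
      MeasureTheory.measure_congr (ZSpan.fundamentalDomain_ae_parallelepiped o.toBasis _)]
    simp [hD, o.volume_parallelepiped]
  have hD1 : D * √s ^ n = 1 := by
    have h0 : 0 ≤ D * √s ^ n := by positivity
    have : (D * √s ^ n) ^ 2 = 1 := by
      rw [mul_pow, hD2, ← pow_mul, mul_comm n 2, pow_mul, Real.sq_sqrt hs.le, mul_comm, hg]
    nlinarith
  have hDpos : 0 < D := by
    have h0 : 0 ≤ D := abs_nonneg _
    rcases h0.eq_or_lt with h | h
    · rw [← h] at hD1; simp at hD1
    · exact h
  have fund := ZLattice.isAddFundamentalDomain (L := L) b MeasureTheory.volume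
  set r := √2 / √s with hr
  have hr0 : 0 < r := by positivity
  have hmink : MeasureTheory.volume (ZSpan.fundamentalDomain bR) * 2 ^ finrank ℝ E
      < MeasureTheory.volume (Metric.ball (0 : E) r) := by
    rw [hvol, InnerProductSpace.volume_ball, ← ENNReal.ofReal_pow hr0.le,
      ← ENNReal.ofReal_mul (by positivity),
      show (2 : ENNReal) = ENNReal.ofReal 2 by simp, ← ENNReal.ofReal_pow (by norm_num),
      ← ENNReal.ofReal_mul hDpos.le]
    have hlt : D * 2 ^ n < r ^ n * (√Real.pi ^ n / Real.Gamma (n / 2 + 1)) := by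
      have hrn : r ^ n = D * √2 ^ n := by
        rw [hr, div_pow, div_eq_iff (by positivity), mul_right_comm, hD1, one_mul]
      rw [hrn, mul_assoc]
      exact mul_lt_mul_of_pos_left (ball_numeric n hpos h4) hDpos
    exact (ENNReal.ofReal_lt_ofReal_iff (lt_trans (by positivity) hlt)).mpr hlt
  have : Countable L.toAddSubgroup := inferInstanceAs (Countable L)
  obtain ⟨x, hx0, hx⟩ :=
    MeasureTheory.exists_ne_zero_mem_lattice_of_measure_mul_two_pow_lt_measure
      (L := L.toAddSubgroup) fund (s := Metric.ball (0 : E) r)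
      (fun x hx => by simpa using hx) (convex_ball _ _) hmink
  refine ⟨x, x.2, ?_⟩
  obtain ⟨z, hz⟩ := hint x x.2 x x.2
  have hxE : (x : E) ≠ 0 := fun h => hx0 (Subtype.ext h)
  have hn1 : 0 < s * inner ℝ (x : E) x := by
    rw [real_inner_self_eq_norm_sq]
    have := norm_pos_iff.mpr hxE
    positivity
  have hn2 : s * inner ℝ (x : E) x < 2 := by
    rw [real_inner_self_eq_norm_sq]
    have h1 : ‖(x : E)‖ < r := by simpa using hx
    have h2 : ‖(x : E)‖ ^ 2 < r ^ 2 := pow_lt_pow_left₀ h1 (norm_nonneg _) (by norm_num)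
    rw [hr, div_pow, Real.sq_sqrt hs.le, Real.sq_sqrt (by norm_num), lt_div_iff₀ hs] at h2
    linarith
  rw [hz] at hn1 hn2 ⊢
  have h1 : 0 < z := by exact_mod_cast hn1
  have h2 : z < 2 := by exact_mod_cast hn2
  have : z = 1 := by omega
  simp [this]

theorem exists_orth {E : Type*} [NormedAddCommGroup E] [InnerProductSpace ℝ E]
    [FiniteDimensional ℝ E] (h4 : finrank ℝ E ≤ 4) (L : Submodule ℤ E)
    (hd : DiscreteTopology L) (hspan : Submodule.span ℝ (L : Set E) = ⊤) (s : ℝ) (hs : 0 < s)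
    (hint : ∀ x ∈ L, ∀ y ∈ L, ∃ z : ℤ, s * inner ℝ x y = z)
    (hdual : ∀ y, (∀ x ∈ L, ∃ z : ℤ, s * inner ℝ x y = z) → y ∈ L) (k : ℕ)
    (hk : k ≤ finrank ℝ E) :
    ∃ e : Fin k → E, (∀ i, e i ∈ L) ∧
      ∀ i j, s * inner ℝ (e i) (e j) = if i = j then (1 : ℝ) else 0 := by
  induction k with
  | zero => exact ⟨Fin.elim0, fun i => i.elim0, fun i => i.elim0⟩
  | succ k ih =>
    obtain ⟨e, heL, he⟩ := ih (by omega)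
    set S := Submodule.span ℝ (Set.range e) with hS
    set W := Sᗮ with hW
    have hWe : ∀ w ∈ W, ∀ i, inner ℝ (e i) w = 0 := fun w hw i =>
      (Submodule.mem_orthogonal _ _).mp hw _ (Submodule.subset_span ⟨i, rfl⟩)
    have hWmem : ∀ w, (∀ i, inner ℝ (e i) w = 0) → w ∈ W := by
      intro w hw
      rw [hW, Submodule.mem_orthogonal]
      intro u hu
      induction hu using Submodule.span_induction with
      | mem x hx => obtain ⟨i, rfl⟩ := hx; exact hw i
      | zero => simp
      | add x y _ _ hx hy => rw [inner_add_left, hx, hy, add_zero]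
      | smul a x _ hx => rw [real_inner_smul_left, hx, mul_zero]
    have hSk : finrank ℝ S ≤ k := by
      have := finrank_range_le_card (R := ℝ) e
      simpa [Set.finrank] using this
    have hsum : finrank ℝ S + finrank ℝ W = finrank ℝ E := Submodule.finrank_add_finrank_orthogonal S
    let π : E →ₗ[ℝ] E :=
      LinearMap.id - ∑ i, (s • (innerₛₗ ℝ (e i))).smulRight (e i)
    have hπ : ∀ x, π x = x - ∑ i, (s * inner ℝ (e i) x) • e i := by
      intro x
      simp [π, LinearMap.sum_apply]
    have hπW : ∀ x, π x ∈ W := by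
      intro x
      apply hWmem
      intro j
      rw [hπ, inner_sub_right, inner_sum]
      have : ∀ i, inner ℝ (e j) ((s * inner ℝ (e i) x) • e i)
          = if j = i then inner ℝ (e i) x else 0 := by
        intro i
        rw [real_inner_smul_right, mul_right_comm, he]
        simp
      simp only [this]
      simp
    have hπL : ∀ x ∈ L, π x ∈ L := by
      intro x hx
      rw [hπ]
      refine Submodule.sub_mem _ hx (Submodule.sum_mem _ fun i _ => ?_)
      obtain ⟨z, hz⟩ := hint _ (heL i) _ hx
      rw [hz, Int.cast_smul_eq_zsmul]
      exact Submodule.smul_mem _ _ (heL i)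
    have hπid : ∀ w ∈ W, π w = w := by
      intro w hw
      rw [hπ]
      simp [hWe w hw]
    have hrat : IsRational L W := by
      apply le_antisymm
      · rw [Submodule.span_le]; exact fun x hx => hx.2
      · intro w hw
        have h1 : Submodule.span ℝ (L : Set E)
            ≤ (Submodule.span ℝ ((L : Set E) ∩ (W : Set E))).comap π := by
          rw [Submodule.span_le]
          intro x hx
          exact Submodule.subset_span ⟨hπL x hx, hπW x⟩
        have h2 := h1 (hspan ▸ Submodule.mem_top : w ∈ Submodule.span ℝ (L : Set E))
        rwa [Submodule.mem_comap, hπid w hw] at h2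
    obtain ⟨u, huL, hu⟩ := exists_unit (E := W) (by omega) (by omega) (latIn L W)
      (latIn_discrete L hd W) (latIn_span L W hrat) s hs
      (fun x hx y hy => hint (x : E) hx (y : E) hy) (by
        intro y hy
        apply hdual
        intro x hx
        obtain ⟨z, hz⟩ := hy ⟨π x, hπW x⟩ (hπL x hx)
        refine ⟨z, ?_⟩
        rw [← hz]
        have h3 : inner ℝ (π x) (y : E) = inner ℝ x (y : E) := by
          rw [hπ, inner_sub_left, sum_inner]
          simp [real_inner_smul_left, hWe y y.2]
        change s * inner ℝ x (y : E) = s * inner ℝ (π x) (y : E)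
        rw [h3])
    have hu' : s * inner ℝ (u : E) (u : E) = 1 := hu
    refine ⟨Fin.snoc e (u : E), ?_, ?_⟩
    · intro i
      refine Fin.lastCases ?_ (fun i => ?_) i
      · rw [Fin.snoc_last]; exact huL
      · rw [Fin.snoc_castSucc]; exact heL i
    · intro i j
      refine Fin.lastCases ?_ (fun i => ?_) i <;> refine Fin.lastCases ?_ (fun j => ?_) j
      · simp only [Fin.snoc_last]; rw [hu']; simp
      · simp only [Fin.snoc_last, Fin.snoc_castSucc]
        rw [real_inner_comm, hWe u u.2, if_neg (Fin.castSucc_lt_last j).ne']; simp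
      · simp only [Fin.snoc_last, Fin.snoc_castSucc]
        rw [hWe u u.2, if_neg (Fin.castSucc_lt_last i).ne]; simp
      · simp only [Fin.snoc_castSucc]
        rw [he]; simp

theorem sign_all {E : Type*} [NormedAddCommGroup E] [InnerProductSpace ℝ E]
    (τ : E →ₗ[ℝ] E)
    (h : ∃ s : ℤ, HasSignature (bform τ) s ∧ s.natAbs = finrank ℝ E) :
    (∀ x, x ≠ 0 → 0 < bform τ x x) ∨ (∀ x, x ≠ 0 → bform τ x x < 0) := by
  obtain ⟨s, ⟨n, v, horth, hs⟩, hn⟩ := h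
  rw [finrank_eq_card_basis v, Fintype.card_fin] at hn
  have hx : ∀ x, bform τ x x = ∑ i, (v.repr x i) ^ 2 * bform τ (v i) (v i) := by
    intro x
    conv_lhs => rw [← v.sum_repr x]
    simp only [bform, map_sum, map_smul, sum_inner, inner_sum, real_inner_smul_left,
      real_inner_smul_right]
    refine Finset.sum_congr rfl fun i _ => ?_
    rw [Finset.sum_eq_single i]
    · ring
    · intro j _ hj
      have := horth j i hj
      unfold bform at this
      rw [this]; ring
    · simp
  have hne : ∀ x, x ≠ 0 → ∃ i, v.repr x i ≠ 0 := by
    intro x hx0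
    by_contra! hcon
    apply hx0
    rw [← v.sum_repr x]
    simp [hcon]
  set P := Finset.univ.filter fun i => 0 < bform τ (v i) (v i) with hP
  set N := Finset.univ.filter fun i => bform τ (v i) (v i) < 0 with hN
  have hPN : P.card + N.card ≤ n := by
    have hdis : Disjoint P N := by
      rw [Finset.disjoint_left]
      intro i hi hi'
      simp only [hP, hN, Finset.mem_filter, Finset.mem_univ, true_and] at hi hi'
      linarith
    rw [← Finset.card_union_of_disjoint hdis]
    simpa using Finset.card_le_univ (P ∪ N)
  have hcase : P.card = n ∨ N.card = n := by omega
  rcases hcase with hc | hc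
  · left
    have hall : ∀ i, 0 < bform τ (v i) (v i) := by
      have : P = Finset.univ := Finset.card_eq_iff_eq_univ P |>.mp (by simpa using hc)
      intro i
      have hi : i ∈ P := by rw [this]; exact Finset.mem_univ i
      simpa [hP] using hi
    intro x hx0
    obtain ⟨i, hi⟩ := hne x hx0
    rw [hx]
    refine Finset.sum_pos' (fun j _ => mul_nonneg (sq_nonneg _) (hall j).le)
      ⟨i, Finset.mem_univ i, mul_pos (by positivity) (hall i)⟩
  · right
    have hall : ∀ i, bform τ (v i) (v i) < 0 := by
      have : N = Finset.univ := Finset.card_eq_iff_eq_univ N |>.mp (by simpa using hc)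
      intro i
      have hi : i ∈ N := by rw [this]; exact Finset.mem_univ i
      simpa [hN] using hi
    intro x hx0
    obtain ⟨i, hi⟩ := hne x hx0
    rw [hx]
    rw [← neg_pos, ← Finset.sum_neg_distrib]
    refine Finset.sum_pos' (fun j _ => ?_) ⟨i, Finset.mem_univ i, ?_⟩
    · have := mul_nonneg (sq_nonneg (v.repr x j)) (neg_nonneg.mpr (hall j).le)
      linarith
    · have := mul_pos (by positivity : 0 < (v.repr x i) ^ 2) (neg_pos.mpr (hall i))
      linarith

theorem unimodular_of_definite {E : Type*} [NormedAddCommGroup E] [InnerProductSpace ℝ E]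
    (L : Submodule ℤ E) (τ : E →ₗ[ℝ] E) (hτ : IsIsodual L τ)
    (hτs : ∀ x y, bform τ x y = bform τ y x)
    (hτdef : ∃ s : ℤ, HasSignature (bform τ) s ∧ s.natAbs = finrank ℝ E) :
    ∃ s : ℝ, 0 < s ∧ (∀ x ∈ L, ∀ y ∈ L, ∃ z : ℤ, s * inner ℝ x y = z) ∧
      (∀ y, (∀ x ∈ L, ∃ z : ℤ, s * inner ℝ x y = z) → y ∈ L) := by
  obtain ⟨⟨α, hα, hsim⟩, hmap⟩ := hτ
  have hττ : ∀ x, τ (τ x) = α • x := by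
    intro x
    refine ext_inner_right ℝ fun y => ?_
    have h1 := hτs (τ x) y
    unfold bform at h1
    rw [h1, hsim, real_inner_smul_left, real_inner_comm]
  have hsα : √α * √α = α := Real.mul_self_sqrt hα.le
  have hsp : 0 < √α := Real.sqrt_pos.mpr hα
  have key : ∃ ε : ℤ, ε * ε = 1 ∧ ∀ x, τ x = ((ε : ℝ) * √α) • x := by
    rcases sign_all τ hτdef with h | h
    · refine ⟨1, by norm_num, fun x => ?_⟩
      by_contra hne
      have hy0 : τ x - √α • x ≠ 0 := by
        intro h0; apply hne; rw [sub_eq_zero.mp h0]; simp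
      have h2 := h _ hy0
      have h3 : τ (τ x - √α • x) = -(√α • (τ x - √α • x)) := by
        rw [map_sub, map_smul, hττ, smul_sub, smul_smul, hsα]; abel
      unfold bform at h2
      rw [h3, inner_neg_left, real_inner_smul_left] at h2
      have h4 := mul_nonneg hsp.le (real_inner_self_nonneg (x := τ x - √α • x))
      linarith
    · refine ⟨-1, by norm_num, fun x => ?_⟩
      by_contra hne
      have hy0 : τ x + √α • x ≠ 0 := by
        intro h0; apply hne; rw [eq_neg_of_add_eq_zero_left h0]; simp
      have h2 := h _ hy0
      have h3 : τ (τ x + √α • x) = √α • (τ x + √α • x) := by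
        rw [map_add, map_smul, hττ, smul_add, smul_smul, hsα]; abel
      unfold bform at h2
      rw [h3, real_inner_smul_left] at h2
      have h4 := mul_nonneg hsp.le (real_inner_self_nonneg (x := τ x + √α • x))
      linarith
  obtain ⟨ε, hε, hτε⟩ := key
  have hεR : (ε : ℝ) * ε = 1 := by exact_mod_cast hε
  refine ⟨√α, hsp, ?_, ?_⟩
  · intro x hx y hy
    have h1 : τ y ∈ dualLat L := by
      rw [← hmap]; exact ⟨y, hy, rfl⟩
    obtain ⟨z, hz⟩ := h1 x hx
    refine ⟨ε * z, ?_⟩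
    rw [hτε, real_inner_smul_right] at hz
    push_cast
    rw [← hz]
    linear_combination (-(√α * inner ℝ x y)) * hεR
  · intro y hy
    have h1 : √α • y ∈ dualLat L := by
      intro x hx
      obtain ⟨z, hz⟩ := hy x hx
      exact ⟨z, by rw [real_inner_smul_right, hz]⟩
    rw [← hmap] at h1
    obtain ⟨x, hx, hxy⟩ := h1
    have hxy' : τ x = √α • y := hxy
    rw [hτε] at hxy'
    have h2 : y = ε • x := by
      have h3 : √α • y = √α • (ε • x) := by
        rw [← hxy', ← Int.cast_smul_eq_zsmul ℝ, smul_smul, mul_comm]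
      exact smul_right_injective E hsp.ne' h3
    rw [h2]
    exact Submodule.smul_mem _ _ hx

theorem tensor_discrete {E F G : Type*} [NormedAddCommGroup E] [InnerProductSpace ℝ E]
    [FiniteDimensional ℝ E] [NormedAddCommGroup F] [InnerProductSpace ℝ F]
    [FiniteDimensional ℝ F] [NormedAddCommGroup G] [InnerProductSpace ℝ G]
    (L : Submodule ℤ E) (M : Submodule ℤ F) (hL : IsLat L) (hM : IsLat M)
    (tp : E →ₗ[ℝ] F →ₗ[ℝ] G) (h : Function.Bijective (TensorProduct.lift tp)) :
    DiscreteTopology (tensorLat tp L M) := by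
  have hLd := hL.1
  have hMd := hM.1
  have : IsZLattice ℝ L := ⟨hL.2⟩
  have : IsZLattice ℝ M := ⟨hM.2⟩
  let bE := (Module.Free.chooseBasis ℤ L).ofZLatticeBasis ℝ L
  let bF := (Module.Free.chooseBasis ℤ M).ofZLatticeBasis ℝ M
  have hE : Submodule.span ℤ (Set.range bE) = L := Basis.ofZLatticeBasis_span ℝ L _
  have hF : Submodule.span ℤ (Set.range bF) = M := Basis.ofZLatticeBasis_span ℝ M _
  let bG := (bE.tensorProduct bF).map (LinearEquiv.ofBijective _ h)
  have hle : tensorLat tp L M ≤ Submodule.span ℤ (Set.range bG) := by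
    unfold tensorLat
    rw [Submodule.span_le]
    rintro _ ⟨x, hx, y, hy, rfl⟩
    change x ∈ L at hx
    change y ∈ M at hy
    change tp x y ∈ Submodule.span ℤ (Set.range bG)
    rw [← hE] at hx
    rw [← hF] at hy
    induction hx using Submodule.span_induction with
    | mem x hx =>
      obtain ⟨i, rfl⟩ := hx
      induction hy using Submodule.span_induction with
      | mem y hy =>
        obtain ⟨j, rfl⟩ := hy
        apply Submodule.subset_span
        refine ⟨(i, j), ?_⟩
        simp [bG]
      | zero => simp
      | add a b _ _ ha hb => rw [map_add]; exact add_mem ha hb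
      | smul z a _ ha => rw [map_zsmul]; exact Submodule.smul_mem _ _ ha
    | zero => simp
    | add a b _ _ ha hb => rw [map_add, LinearMap.add_apply]; exact add_mem ha hb
    | smul z a _ ha =>
      rw [map_zsmul, LinearMap.smul_apply]; exact Submodule.smul_mem _ _ ha
  have hfd : Finite (Module.Free.ChooseBasisIndex ℤ L × Module.Free.ChooseBasisIndex ℤ M) :=
    inferInstance
  have hd : DiscreteTopology (Submodule.span ℤ (Set.range bG)) := inferInstance
  exact DiscreteTopology.of_subset (s := (Submodule.span ℤ (Set.range bG) : Set G)) hd hle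

theorem Hmin_subsingleton {G : Type*} [NormedAddCommGroup G] [InnerProductSpace ℝ G]
    [Subsingleton G] (Λ : Submodule ℤ G) : Hmin Λ = 0 := by
  unfold Hmin
  convert Real.sInf_empty
  ext h
  simp only [Set.mem_ofPred_eq, Set.mem_empty_iff_false, iff_false]
  rintro ⟨F, hF, -⟩
  exact hF (Subsingleton.elim _ _)

theorem exists_ne_zero_of_span {F : Type*} [NormedAddCommGroup F] [InnerProductSpace ℝ F]
    [Nontrivial F] (M : Submodule ℤ F) (h : Submodule.span ℝ (M : Set F) = ⊤) :
    ∃ x ∈ M, x ≠ 0 := by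
  by_contra! hc
  have : Submodule.span ℝ (M : Set F) = ⊥ := by
    rw [Submodule.span_eq_bot]; exact hc
  rw [this] at h
  exact bot_ne_top h

theorem gram_pos {G : Type*} [NormedAddCommGroup G] [InnerProductSpace ℝ G]
    {n : ℕ} (v : Fin n → G) (h : LinearIndependent ℝ v) : 0 < (Matrix.gram ℝ v).det :=
  (Matrix.posDef_gram_of_linearIndependent h).det_pos

theorem Pc_integral {E : Type*} [NormedAddCommGroup E] [InnerProductSpace ℝ E]
    [FiniteDimensional ℝ E] (L : Submodule ℤ E) (hd : DiscreteTopology L) (s : ℝ) (hs : 0 < s)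
    (hint : ∀ x ∈ L, ∀ y ∈ L, ∃ z : ℤ, s * inner ℝ x y = z) : Pc L (√(s⁻¹)) := by
  intro n v hv hli
  have hpos := gram_pos v (li_real L hd v hv hli)
  choose z hz using fun i j => hint (v i) (hv i) (v j) (hv j)
  have hmat : s • Matrix.gram ℝ v = (Matrix.of z).map (Int.cast : ℤ → ℝ) := by
    ext i j
    simp [Matrix.gram_apply, hz]
  have hdet : s ^ n * (Matrix.gram ℝ v).det = (((Matrix.of z).det : ℤ) : ℝ) := by
    have := congrArg Matrix.det hmat
    rw [Matrix.det_smul, Fintype.card_fin] at this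
    rw [this]
    exact ((Int.castRingHom ℝ).map_det (Matrix.of z)).symm
  have h1 : (0 : ℝ) < (((Matrix.of z).det : ℤ) : ℝ) := by rw [← hdet]; positivity
  have h2 : (1 : ℤ) ≤ (Matrix.of z).det := by exact_mod_cast h1
  have h3 : (1 : ℝ) ≤ s ^ n * (Matrix.gram ℝ v).det := by rw [hdet]; exact_mod_cast h2
  rw [pow_mul, Real.sq_sqrt (by positivity), inv_pow]
  rw [inv_le_iff_one_le_mul₀' (by positivity)]
  exact h3

theorem Hmin_unimodular {E : Type*} [NormedAddCommGroup E] [InnerProductSpace ℝ E]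
    [FiniteDimensional ℝ E] (L : Submodule ℤ E) (hd : DiscreteTopology L) (s : ℝ) (hs : 0 < s)
    (hint : ∀ x ∈ L, ∀ y ∈ L, ∃ z : ℤ, s * inner ℝ x y = z)
    (e : E) (he : e ∈ L) (hee : s * inner ℝ e e = 1) : Hmin L = √(s⁻¹) := by
  have he0 : e ≠ 0 := by rintro rfl; simp at hee
  apply le_antisymm
  · have h := Pc_Hmin L hd 1 (fun _ => e) (fun _ => he) (by
      have hR : LinearIndependent ℝ (fun _ : Fin 1 => e) := by
        rw [linearIndependent_unique_iff]; exact he0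
      exact hR.restrict_scalars (by
        intro a b hab
        simpa using hab))
    apply Real.le_sqrt_of_sq_le
    have h2 : (Matrix.gram ℝ (fun _ : Fin 1 => e)).det = s⁻¹ := by
      rw [Matrix.det_unique, Matrix.gram_apply]
      exact eq_inv_of_mul_eq_one_right hee
    rw [h2] at h
    simpa using h
  · exact le_Hmin L hd ⟨e, he, he0⟩ _ (Pc_integral L hd s hs hint)

theorem orth_expand {E : Type*} [NormedAddCommGroup E] [InnerProductSpace ℝ E]
    [FiniteDimensional ℝ E] (s : ℝ) (hs : 0 < s) (e : Fin (finrank ℝ E) → E)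
    (he : ∀ i j, s * inner ℝ (e i) (e j) = if i = j then 1 else 0) (x : E) :
    x = ∑ i, (s * inner ℝ (e i) x) • e i := by
  have hli : LinearIndependent ℝ e := by
    apply linearIndependent_of_ne_zero_of_inner_eq_zero
    · intro i h
      have := he i i
      simp [h] at this
    · intro i j hij
      have := he i j
      rw [if_neg hij] at this
      exact (mul_eq_zero.mp this).resolve_left hs.ne'
  have htop := hli.span_eq_top_of_card_eq_finrank' (by simp)
  have hx : x ∈ Submodule.span ℝ (Set.range e) := by rw [htop]; trivial
  obtain ⟨c, rfl⟩ := (Submodule.mem_span_range_iff_exists_fun ℝ).mp hx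
  apply Finset.sum_congr rfl
  intro i _
  congr 1
  rw [inner_sum, Finset.mul_sum, Finset.sum_eq_single i]
  · rw [real_inner_smul_right, mul_left_comm, he i i]; simp
  · intro j _ hj
    rw [real_inner_smul_right, mul_left_comm, he i j, if_neg hj.symm]; simp
  · simp

theorem Hmin_tensor {E F G : Type*} [NormedAddCommGroup E] [InnerProductSpace ℝ E]
    [FiniteDimensional ℝ E] [NormedAddCommGroup F] [InnerProductSpace ℝ F]
    [FiniteDimensional ℝ F] [NormedAddCommGroup G] [InnerProductSpace ℝ G]
    [FiniteDimensional ℝ G]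
    (L : Submodule ℤ E) (M : Submodule ℤ F) (hMd : DiscreteTopology M)
    (hMne : ∃ x ∈ M, x ≠ 0)
    (tp : E →ₗ[ℝ] F →ₗ[ℝ] G) (htp : ∀ (x x' : E) (y y' : F),
      (inner ℝ (tp x y) (tp x' y') : ℝ) = (inner ℝ x x' : ℝ) * (inner ℝ y y' : ℝ))
    (hd : DiscreteTopology (tensorLat tp L M)) (s : ℝ) (hs : 0 < s)
    (hint : ∀ x ∈ L, ∀ y ∈ L, ∃ z : ℤ, s * inner ℝ x y = z)
    (e : Fin (finrank ℝ E) → E) (heL : ∀ i, e i ∈ L)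
    (he : ∀ i j, s * inner ℝ (e i) (e j) = if i = j then 1 else 0)
    (i₀ : Fin (finrank ℝ E)) :
    Hmin (tensorLat tp L M) = √(s⁻¹) * Hmin M := by
  have hβ : 0 < s⁻¹ := inv_pos.mpr hs
  have hee : ∀ i, inner ℝ (e i) (e i) = s⁻¹ := by
    intro i
    have := he i i
    rw [if_pos rfl] at this
    exact eq_inv_of_mul_eq_one_right this
  have hsc : ∀ i x y, inner ℝ (tp (e i) x) (tp (e i) y) = s⁻¹ * inner ℝ x y := by
    intro i x y; rw [htp, hee]
  have hinj : Function.Injective (tp (e i₀)) := by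
    rw [injective_iff_map_eq_zero]
    intro x hx
    have := hsc i₀ x x
    rw [hx, inner_zero_left] at this
    exact inner_self_eq_zero.mp ((mul_eq_zero.mp this.symm).resolve_left hβ.ne')
  have hmem : ∀ y ∈ M, tp (e i₀) y ∈ tensorLat tp L M := fun y hy =>
    Submodule.subset_span ⟨e i₀, heL i₀, y, hy, rfl⟩
  have hsq : 0 < √(s⁻¹) := Real.sqrt_pos.mpr hβ
  apply le_antisymm
  · have key : Hmin (tensorLat tp L M) / √(s⁻¹) ≤ Hmin M := by
      apply le_Hmin M hMd hMne
      intro n v hv hli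
      have h := Pc_Hmin _ hd n (fun j => tp (e i₀) (v j)) (fun j => hmem _ (hv j))
        (hli.map' ((tp (e i₀)).restrictScalars ℤ) (LinearMap.ker_eq_bot.mpr hinj))
      have hg : Matrix.gram ℝ (fun j => tp (e i₀) (v j)) = s⁻¹ • Matrix.gram ℝ v := by
        ext i j
        simp only [Matrix.gram_apply, Matrix.smul_apply, smul_eq_mul]
        exact hsc i₀ _ _
      rw [hg, Matrix.det_smul, Fintype.card_fin] at h
      rw [div_pow, pow_mul (√(s⁻¹)), Real.sq_sqrt hβ.le, div_le_iff₀ (by positivity)]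
      linarith
    rw [div_le_iff₀ hsq] at key
    linarith
  · have hle : tensorLat tp L M ≤
        ⨆ i ∈ (Finset.univ : Finset (Fin (finrank ℝ E))),
          M.map ((tp (e i)).restrictScalars ℤ) := by
      unfold tensorLat
      rw [Submodule.span_le]
      rintro _ ⟨x, hx, y, hy, rfl⟩
      choose z hz using fun i => hint (e i) (heL i) x hx
      have hx' := orth_expand s hs e he x
      have : tp x y = ∑ i, z i • tp (e i) y := by
        conv_lhs => rw [hx']
        rw [map_sum, LinearMap.sum_apply]
        apply Finset.sum_congr rfl
        intro i _
        rw [hz, map_smul, LinearMap.smul_apply, Int.cast_smul_eq_zsmul]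
      change tp x y ∈ _
      rw [this]
      apply Submodule.sum_mem
      intro i hi
      apply Submodule.smul_mem
      exact Submodule.mem_iSup_of_mem i (Submodule.mem_iSup_of_mem hi ⟨y, hy, rfl⟩)
    have hPc := Pc_finset_sup (fun i => M.map ((tp (e i)).restrictScalars ℤ))
      (√(s⁻¹) * Hmin M) (mul_nonneg hsq.le (Hmin_nonneg M)) (by
        rintro i j hij _ ⟨x, -, rfl⟩ _ ⟨y, -, rfl⟩
        change inner ℝ (tp (e i) x) (tp (e j) y) = 0
        have := he i j
        rw [if_neg hij] at this
        rw [htp, (mul_eq_zero.mp this).resolve_left hs.ne', zero_mul])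
      (fun i => Pc_map M (tp (e i)) s⁻¹ (Hmin M) hβ (hsc i) (Pc_Hmin M hMd)) Finset.univ
    obtain ⟨m, hm, hm0⟩ := hMne
    refine le_Hmin _ hd ⟨tp (e i₀) m, hmem m hm, fun h => hm0 (hinj (by rw [h, map_zero]))⟩ _ ?_
    intro n v hv hli
    exact hPc n v (fun i => hle (hv i)) hli

/-- If `(E, L, τ)` and `(F, M, υ)` are orthogonal isodual with `dim E ≤ 4`,
`b_τ` definite and `b_υ` Lorentzian, then tensor multiplicativity of `H_min` holds. -/
theorem statement11 {E F : Type*} [NormedAddCommGroup E] [InnerProductSpace ℝ E]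
    [FiniteDimensional ℝ E] [NormedAddCommGroup F] [InnerProductSpace ℝ F]
    [FiniteDimensional ℝ F] (L : Submodule ℤ E) (M : Submodule ℤ F)
    (hL : IsLat L) (hM : IsLat M)
    (τ : E →ₗ[ℝ] E) (υ : F →ₗ[ℝ] F)
    (hτ : IsIsodual L τ) (hυ : IsIsodual M υ)
    (hτs : ∀ x y, bform τ x y = bform τ y x) (hυs : ∀ x y, bform υ x y = bform υ y x)
    (hdim : finrank ℝ E ≤ 4)
    (hτdef : ∃ s : ℤ, HasSignature (bform τ) s ∧ s.natAbs = finrank ℝ E)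
    (hυlor : ∃ s : ℤ, HasSignature (bform υ) s ∧ (s.natAbs : ℤ) = (finrank ℝ F : ℤ) - 2) :
    ∀ (G : Type*) [NormedAddCommGroup G] [InnerProductSpace ℝ G]
      (tp : E →ₗ[ℝ] F →ₗ[ℝ] G), IsTensor tp →
      Hmin (tensorLat tp L M) = Hmin L * Hmin M := by
  intro G _ _ tp htp
  obtain ⟨s, hs, hint, hdual⟩ := unimodular_of_definite L τ hτ hτs hτdef
  have hfG : FiniteDimensional ℝ G :=
    Module.Finite.equiv (LinearEquiv.ofBijective _ htp.1)
  rcases Nat.eq_zero_or_pos (finrank ℝ E) with h0 | hpos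
  · have hE : Subsingleton E := finrank_zero_iff.mp h0
    have hG : Subsingleton G := by
      apply (finrank_zero_iff (R := ℝ)).mp
      rw [← (LinearEquiv.ofBijective _ htp.1).finrank_eq, finrank_tensorProduct, h0, zero_mul]
    rw [Hmin_subsingleton, Hmin_subsingleton, zero_mul]
  · obtain ⟨e, heL, he⟩ := exists_orth hdim L hL.1 hL.2 s hs hint hdual _ le_rfl
    have hF : Nontrivial F := by
      obtain ⟨t, -, ht⟩ := hυlor
      apply nontrivial_of_finrank_pos (R := ℝ)
      omega
    have hee := he ⟨0, hpos⟩ ⟨0, hpos⟩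
    rw [if_pos rfl] at hee
    rw [Hmin_unimodular L hL.1 s hs hint _ (heL ⟨0, hpos⟩) hee]
    exact Hmin_tensor L M hM.1 (exists_ne_zero_of_span M hM.2) tp htp.2
      (tensor_discrete L M hL hM tp htp.1) s hs hint e heL he ⟨0, hpos⟩

end EucLat
end
end

section
/- Let (E, L) be a 2-dimensional Euclidean lattice admitting a ℤ-basis (e₁, e₂) of L such that ⟪eᵢ, eⱼ⟫ ∈ ℚ for all i, j ∈ {1, 2}. Then (E, L) is isodual: there exist a linear map τ : E → E and a real number α > 0 with ⟪τx, τy⟫ = α⟪x, y⟫ for all x, y ∈ E and τ(L) = L*. -/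
open Module

noncomputable section

namespace EucLat

variable {E : Type*} [NormedAddCommGroup E] [InnerProductSpace ℝ E]

/-- A 2-dimensional Euclidean lattice whose Gram matrix in some `ℤ`-basis is
rational is isodual. -/
theorem statement15 {E : Type*} [NormedAddCommGroup E] [InnerProductSpace ℝ E]
    [FiniteDimensional ℝ E] (L : Submodule ℤ E) (hL : IsLat L)
    (hdim : finrank ℝ E = 2) (b : Basis (Fin 2) ℤ L)
    (hb : ∀ i j : Fin 2, ∃ q : ℚ, (inner ℝ ((b i : L) : E) ((b j : L) : E) : ℝ) = q) :
    ∃ τ : E →ₗ[ℝ] E, IsIsodual L τ := by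
  obtain ⟨-, hspan⟩ := hL
  obtain ⟨e₁, he₁⟩ : ∃ e : E, e = ((b 0 : L) : E) := ⟨_, rfl⟩
  obtain ⟨e₂, he₂⟩ : ∃ e : E, e = ((b 1 : L) : E) := ⟨_, rfl⟩
  have hm₁ : e₁ ∈ L := he₁ ▸ (b 0).2
  have hm₂ : e₂ ∈ L := he₂ ▸ (b 1).2
  have hmem : ∀ x ∈ L, ∃ m n : ℤ, x = (m : ℝ) • e₁ + (n : ℝ) • e₂ := by
    intro x hx
    refine ⟨b.repr ⟨x, hx⟩ 0, b.repr ⟨x, hx⟩ 1, ?_⟩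
    have h := congrArg (Subtype.val) (b.sum_repr ⟨x, hx⟩)
    rw [Fin.sum_univ_two] at h
    simp only [Submodule.coe_add, Submodule.coe_smul] at h
    rw [Int.cast_smul_eq_zsmul, Int.cast_smul_eq_zsmul, he₁, he₂]
    exact h.symm
  have hmem' : ∀ m n : ℤ, (m : ℝ) • e₁ + (n : ℝ) • e₂ ∈ L := by
    intro m n
    rw [Int.cast_smul_eq_zsmul, Int.cast_smul_eq_zsmul]
    exact L.add_mem (L.smul_mem _ hm₁) (L.smul_mem _ hm₂)
  have htop : ⊤ ≤ Submodule.span ℝ (Set.range ![e₁, e₂]) := by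
    rw [← hspan, Submodule.span_le]
    intro x hx
    obtain ⟨m, n, rfl⟩ := hmem x hx
    refine Submodule.add_mem _ (Submodule.smul_mem _ _ (Submodule.subset_span ⟨0, rfl⟩))
      (Submodule.smul_mem _ _ (Submodule.subset_span ⟨1, rfl⟩))
  let B : Basis (Fin 2) ℝ E := basisOfTopLeSpanOfCardEqFinrank ![e₁, e₂] htop (by simp [hdim])
  have hB : ⇑B = ![e₁, e₂] := coe_basisOfTopLeSpanOfCardEqFinrank _ _ _
  have hB0 : B 0 = e₁ := by rw [hB]; rfl
  have hB1 : B 1 = e₂ := by rw [hB]; rfl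
  have hcoord : ∀ x : E, ∃ s t : ℝ, x = s • e₁ + t • e₂ := by
    intro x
    refine ⟨B.repr x 0, B.repr x 1, ?_⟩
    have h := B.sum_repr x
    rw [Fin.sum_univ_two, hB0, hB1] at h
    exact h.symm
  have hli : LinearIndependent ℝ ![e₁, e₂] := hB ▸ B.linearIndependent
  rw [LinearIndependent.pair_iff] at hli
  obtain ⟨a, ha⟩ : ∃ a : ℝ, inner ℝ e₁ e₁ = a := ⟨_, rfl⟩
  obtain ⟨c, hc⟩ : ∃ a : ℝ, inner ℝ e₂ e₂ = a := ⟨_, rfl⟩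
  obtain ⟨d, hd⟩ : ∃ a : ℝ, inner ℝ e₁ e₂ = a := ⟨_, rfl⟩
  have hd' : inner ℝ e₂ e₁ = d := by rw [real_inner_comm]; exact hd
  have hc0 : 0 < c := by
    rw [← hc]
    refine real_inner_self_pos.2 ?_
    intro h
    have := hli 0 1 (by simp [h])
    simp at this
  have hD : 0 < a * c - d ^ 2 := by
    have h1 : 0 < inner ℝ (c • e₁ - d • e₂) (c • e₁ - d • e₂) := by
      refine real_inner_self_pos.2 ?_
      intro h
      have := (hli c (-d) (by rw [neg_smul, ← sub_eq_add_neg]; exact h)).1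
      exact hc0.ne' this
    simp only [inner_sub_left, inner_sub_right, real_inner_smul_left, real_inner_smul_right,
      ha, hc, hd, hd'] at h1
    have h2 : 0 < c * (a * c - d ^ 2) := by nlinarith
    exact (pos_iff_pos_of_mul_pos h2).1 hc0
  obtain ⟨D, hDD⟩ : ∃ D : ℝ, D = a * c - d ^ 2 := ⟨_, rfl⟩
  rw [← hDD] at hD
  have hDne : D ≠ 0 := hD.ne'
  let τ : E →ₗ[ℝ] E := B.constr ℝ
    ![(-d / D) • e₁ + (a / D) • e₂, (-c / D) • e₁ + (d / D) • e₂]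
  have hτ1 : τ e₁ = (-d / D) • e₁ + (a / D) • e₂ := by
    have h := B.constr_basis ℝ ![(-d / D) • e₁ + (a / D) • e₂, (-c / D) • e₁ + (d / D) • e₂] 0
    rw [hB0] at h; exact h
  have hτ2 : τ e₂ = (-c / D) • e₁ + (d / D) • e₂ := by
    have h := B.constr_basis ℝ ![(-d / D) • e₁ + (a / D) • e₂, (-c / D) • e₁ + (d / D) • e₂] 1
    rw [hB1] at h; exact h
  have hτ : ∀ s t : ℝ, τ (s • e₁ + t • e₂) =
      ((-d * s - c * t) / D) • e₁ + ((a * s + d * t) / D) • e₂ := by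
    intro s t
    rw [map_add, map_smul, map_smul, hτ1, hτ2]
    module
  have hin : ∀ s t u v : ℝ, inner ℝ (s • e₁ + t • e₂) (u • e₁ + v • e₂) =
      s * u * a + (s * v + t * u) * d + t * v * c := by
    intro s t u v
    simp only [inner_add_left, inner_add_right, real_inner_smul_left, real_inner_smul_right,
      ha, hc, hd, hd']
    ring
  refine ⟨τ, ⟨D⁻¹, inv_pos.2 hD, ?_⟩, ?_⟩
  · intro x y
    obtain ⟨s, t, rfl⟩ := hcoord x
    obtain ⟨u, v, rfl⟩ := hcoord y
    rw [hτ, hτ, hin, hin]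
    field_simp
    rw [hDD]
    ring
  · ext y
    rw [Submodule.mem_map]
    constructor
    · rintro ⟨x, hx, rfl⟩ z hz
      obtain ⟨m, n, rfl⟩ := hmem x hx
      obtain ⟨p, q, rfl⟩ := hmem z hz
      refine ⟨q * m - p * n, ?_⟩
      rw [LinearMap.restrictScalars_apply, hτ, hin]
      push_cast
      field_simp
      rw [hDD]
      ring
    · intro hy
      obtain ⟨m, hm⟩ := hy e₁ hm₁
      obtain ⟨n, hn⟩ := hy e₂ hm₂
      obtain ⟨s, t, rfl⟩ := hcoord y
      simp only [inner_add_right, real_inner_smul_right, ha, hc, hd, hd'] at hm hn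
      refine ⟨(n : ℝ) • e₁ + ((-m : ℤ) : ℝ) • e₂, hmem' _ _, ?_⟩
      rw [LinearMap.restrictScalars_apply, hτ]
      push_cast
      rw [← hm, ← hn]
      congr 2
      · field_simp
        rw [hDD]
        ring
      · field_simp
        rw [hDD]
        ring

end EucLat
end
end
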